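/- The Gauss hypergeometric series satisfies ₂F₁(1/2, 3/4; 1; 1/81) = (9/100) · √2 · 5^{3/4} · Γ(1/4)² / π^{3/2}, where Γ denotes the Gamma function. -/

import Mathlib

open scoped Nat

/-- Pochhammer symbol (rising factorial) on the reals. -/
noncomputable def poch (a : ℝ) (n : ℕ) : ℝ := ∏ i ∈ Finset.range n, (a + i)

/-- Gauss hypergeometric series ₂F₁(a,b;c;x) as a real series. -/
noncomputable def twoFone (a b c x : ℝ) : ℝ :=
  ∑' n : ℕ, poch a n * poch b n / (poch c n * (n ! : ℝ)) * x ^ n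

open MeasureTheory Set

lemma poch_eq (a : ℝ) (n : ℕ) : poch a n = (ascPochhammer ℝ n).eval a := by
  induction n with
  | zero => simp [poch]
  | succ k ih => rw [ascPochhammer_succ_eval, ← ih, poch, Finset.prod_range_succ, poch]

lemma choose_eq_poch (a : ℝ) (n : ℕ) : Ring.choose (a + n - 1) n = poch a n / n ! := by
  have h := Ring.factorial_nsmul_multichoose_eq_ascPochhammer a n
  have h2 : Ring.choose (a + n - 1) n = Ring.multichoose a n := by
    rw [Ring.choose]; congr 1; ring
  rw [h2, poch_eq, eq_div_iff (by positivity), mul_comm, ← nsmul_eq_mul, h,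
    Polynomial.ascPochhammer_smeval_eq_eval]

lemma binom_hasSum (y : ℝ) (h0 : 0 ≤ y) (h1 : y < 1) :
    HasSum (fun n : ℕ => poch (3/4) n / n ! * y ^ n) ((1 - y) ^ (-(3/4) : ℝ)) := by
  have h := (Real.one_div_one_sub_rpow_hasFPowerSeriesOnBall_zero (3/4)).hasSum (y := y) (by
    simp [enorm_eq_nnnorm, abs_of_nonneg h0, ← NNReal.coe_lt_coe, h1])
  rw [Real.rpow_neg (by linarith)]
  simpa [FormalMultilinearSeries.ofScalars, choose_eq_poch, smul_eq_mul] using h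

lemma poch_one (n : ℕ) : poch 1 n = n ! := by
  rw [poch_eq, ascPochhammer_eval_one]

lemma poch_half (n : ℕ) :
    ∏ i ∈ Finset.range n, (2 * (i : ℝ) + 1) / (2 * i + 2) = poch (1/2) n / n ! := by
  induction n with
  | zero => simp [poch]
  | succ k ih =>
    rw [Finset.prod_range_succ, ih, poch, poch, Finset.prod_range_succ, Nat.factorial_succ]
    push_cast
    field_simp
    ring

lemma poch_nonneg (n : ℕ) : 0 ≤ poch (3/4) n := by
  unfold poch; exact Finset.prod_nonneg (fun i _ => by positivity)

lemma series_int : twoFone (1/2) (3/4) 1 (1/81) =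
    (2 / Real.pi) * ∫ t in Ioo 0 (Real.pi/2), (1 - Real.cos t ^ 2 / 81) ^ (-(3/4) : ℝ) := by
  have H := intervalIntegral.hasSum_integral_of_dominated_convergence (μ := volume)
    (a := 0) (b := Real.pi / 2)
    (F := fun (n : ℕ) t => poch (3/4) n / n ! * (Real.cos t ^ 2 / 81) ^ n)
    (f := fun t => (1 - Real.cos t ^ 2 / 81) ^ (-(3/4) : ℝ))
    (fun n _ => poch (3/4) n / n ! * (1/81) ^ n)
    (fun n => Continuous.aestronglyMeasurable (by fun_prop))
    (fun n => by
      filter_upwards with t _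
      have := poch_nonneg n
      rw [Real.norm_of_nonneg (by positivity)]
      gcongr
      exact Real.cos_sq_le_one t)
    (by
      filter_upwards with t _
      exact (binom_hasSum (1/81) (by norm_num) (by norm_num)).summable)
    (by simp)
    (by
      filter_upwards with t _
      apply binom_hasSum _ (by positivity)
      have := Real.cos_sq_le_one t
      linarith)
  rw [← integral_Ioc_eq_integral_Ioo, ← intervalIntegral.integral_of_le (by positivity),
    ← H.tsum_eq, ← tsum_mul_left, twoFone]
  congr 1
  ext n
  rw [intervalIntegral.integral_const_mul]
  simp_rw [div_pow, ← pow_mul]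
  rw [intervalIntegral.integral_div, EulerSine.integral_cos_pow_eq, integral_sin_pow_even,
    poch_half, poch_one]
  have := Real.pi_pos
  field_simp
  simp

lemma subst_lem {a b : ℝ} (hab : a < b) {f f' : ℝ → ℝ} (hc : ContinuousOn f (Icc a b))
    (hd : ∀ x ∈ Ioo a b, HasDerivAt f (f' x) x) (hp : ∀ x ∈ Ioo a b, 0 < f' x) (g h : ℝ → ℝ)
    (hg : ∀ x ∈ Ioo a b, f' x * g (f x) = h x) :
    (∫ x in Ioo (f a) (f b), g x = ∫ x in Ioo a b, h x) ∧
    (IntegrableOn g (Ioo (f a) (f b)) ↔ IntegrableOn h (Ioo a b)) := by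
  have hm : StrictMonoOn f (Icc a b) := strictMonoOn_of_deriv_pos (convex_Icc a b) hc
    (by rw [interior_Icc]; intro x hx; rw [(hd x hx).deriv]; exact hp x hx)
  have him := hc.image_Ioo_of_strictMonoOn hab.le hm
  have hinj : InjOn f (Ioo a b) := (hm.mono Ioo_subset_Icc_self).injOn
  have hE : EqOn (fun x => |f' x| • g (f x)) h (Ioo a b) := by
    intro x hx
    simp only [smul_eq_mul, abs_of_pos (hp x hx), hg x hx]
  rw [← him, integral_image_eq_integral_abs_deriv_smul measurableSet_Ioo
    (fun x hx => (hd x hx).hasDerivWithinAt) hinj,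
    integrableOn_image_iff_integrableOn_abs_deriv_smul measurableSet_Ioo
    (fun x hx => (hd x hx).hasDerivWithinAt) hinj]
  exact ⟨setIntegral_congr_fun measurableSet_Ioo hE, integrableOn_congr_fun hE measurableSet_Ioo⟩

lemma subst_anti {a b : ℝ} (hab : a < b) {f f' : ℝ → ℝ} (hc : ContinuousOn f (Icc a b))
    (hd : ∀ x ∈ Ioo a b, HasDerivAt f (f' x) x) (hp : ∀ x ∈ Ioo a b, f' x < 0) (g h : ℝ → ℝ)
    (hg : ∀ x ∈ Ioo a b, - f' x * g (f x) = h x) :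
    (∫ x in Ioo (f b) (f a), g x = ∫ x in Ioo a b, h x) ∧
    (IntegrableOn g (Ioo (f b) (f a)) ↔ IntegrableOn h (Ioo a b)) := by
  have hm : StrictAntiOn f (Icc a b) := strictAntiOn_of_deriv_neg (convex_Icc a b) hc
    (by rw [interior_Icc]; intro x hx; rw [(hd x hx).deriv]; exact hp x hx)
  have him := hc.image_Ioo_of_strictAntiOn hab.le hm
  have hinj : InjOn f (Ioo a b) := (hm.mono Ioo_subset_Icc_self).injOn
  have hE : EqOn (fun x => |f' x| • g (f x)) h (Ioo a b) := by
    intro x hx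
    simp only [smul_eq_mul, abs_of_neg (hp x hx), hg x hx]
  rw [← him, integral_image_eq_integral_abs_deriv_smul measurableSet_Ioo
    (fun x hx => (hd x hx).hasDerivWithinAt) hinj,
    integrableOn_image_iff_integrableOn_abs_deriv_smul measurableSet_Ioo
    (fun x hx => (hd x hx).hasDerivWithinAt) hinj]
  exact ⟨setIntegral_congr_fun measurableSet_Ioo hE, integrableOn_congr_fun hE measurableSet_Ioo⟩

lemma key_poly (r z : ℝ) (hr : r^4 = 5) :
   (5*(2+r^2))^2 * ((1 - 5*r*(7+3*r^2)*z + 5*(2+r^2)*z^2)^4 - z^2*(5*(2+r^2) + 5*r*(7+3*r^2)*z + z^2)^4) = (1 - 2*(12*r*(9+4*r^2))*z - z^2) * ((5*(2+r^2)+3*(5*r*(7+3*r^2))*z+5*z^2)*(1 - 5*r*(7+3*r^2)*z + 5*(2+r^2)*z^2) + 2*z*(5*(2+r^2) + 5*r*(7+3*r^2)*z + z^2)*(5*r*(7+3*r^2)-2*(5*(2+r^2))*z))^2 := by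
  grind

lemma r_bounds (r : ℝ) (h0 : 0 < r) (hr : r^4 = 5) : 1.495 < r ∧ r < 1.4954 := by
  constructor
  · by_contra! h
    have : r^4 ≤ 1.495^4 := by gcongr
    norm_num [hr] at this
  · by_contra! h
    have : (1.4954:ℝ)^4 ≤ r^4 := by gcongr
    norm_num [hr] at this

noncomputable def GG (y : ℝ) : ℝ := 1 / √((y^4 - 80) * (81 - y^4))
noncomputable def qq (r s : ℝ) : ℝ := 1 / √(1 - 2*(12*r*(9+4*r^2))*s^2 - s^4)

lemma stepA (r : ℝ) (h0 : 0 < r) (hr : r^4 = 5) :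
    (∫ y in Ioo (2*r) 3, GG y = (1/54) * ∫ t in Ioo 0 (Real.pi/2), (1 - Real.cos t ^ 2 / 81) ^ (-(3/4) : ℝ)) ∧
    IntegrableOn GG (Ioo (2*r) 3) := by
  have h := subst_lem (a := 0) (b := Real.pi/2) (by positivity)
    (f := fun t => (80 + Real.sin t ^ 2) ^ (1/4 : ℝ))
    (f' := fun t => (2 * Real.sin t * Real.cos t) * (1/4) * (80 + Real.sin t ^ 2) ^ (1/4 - 1 : ℝ))
    (by
      apply Continuous.continuousOn
      apply Continuous.rpow_const (by fun_prop)
      intro x; right; norm_num)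
    (by
      intro x hx
      have h1 : HasDerivAt (fun t => 80 + Real.sin t ^ 2) (2 * Real.sin x * Real.cos x) x := by
        simpa using ((Real.hasDerivAt_sin x).pow 2).const_add 80
      exact h1.rpow_const (Or.inl (by positivity)))
    (by
      intro x hx
      have := Real.sin_pos_of_pos_of_lt_pi hx.1 (by linarith [hx.2, Real.pi_pos])
      have := Real.cos_pos_of_mem_Ioo ⟨by linarith [hx.1, Real.pi_pos], hx.2⟩
      positivity)
    GG (fun t => (1/54) * (1 - Real.cos t ^ 2 / 81) ^ (-(3/4) : ℝ))
    (by
      intro x hx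
      have hs := Real.sin_pos_of_pos_of_lt_pi hx.1 (by linarith [hx.2, Real.pi_pos])
      have hc := Real.cos_pos_of_mem_Ioo ⟨by linarith [hx.1, Real.pi_pos], hx.2⟩
      have hsc := Real.sin_sq_add_cos_sq x
      have h4 : ((80 + Real.sin x ^ 2) ^ (1/4 : ℝ))^4 = 80 + Real.sin x ^ 2 := by
        rw [← Real.rpow_natCast, ← Real.rpow_mul (by positivity)]; norm_num
      have h5 : (80 + Real.sin x ^ 2) ^ (1/4 - 1 : ℝ) = (1/27) * (1 - Real.cos x ^ 2 / 81) ^ (-(3/4) : ℝ) := by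
        have : 80 + Real.sin x ^ 2 = 81 * (1 - Real.cos x ^ 2 / 81) := by linarith
        rw [this, Real.mul_rpow (by norm_num) (by nlinarith)]
        rw [show (81:ℝ) = 3^(4:ℝ) by norm_num, ← Real.rpow_mul (by norm_num)]
        norm_num
      have h6 : √((80 + Real.sin x ^ 2 - 80) * (81 - (80 + Real.sin x ^ 2))) = Real.sin x * Real.cos x := by
        rw [show (80 + Real.sin x ^ 2 - 80) * (81 - (80 + Real.sin x ^ 2)) = (Real.sin x * Real.cos x)^2 by
          rw [show 81 - (80 + Real.sin x ^ 2) = Real.cos x ^2 by linarith]; ring]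
        exact Real.sqrt_sq (by positivity)
      simp only [GG, h4, h5, h6]
      field_simp
      ring)
  have e0 : (80 + Real.sin 0 ^ 2) ^ (1/4 : ℝ) = 2 * r := by
    rw [show (80 + Real.sin 0 ^ 2 : ℝ) = (2*r)^(4:ℝ) by norm_num; rw [mul_pow, hr]; norm_num,
      ← Real.rpow_mul (by positivity)]
    norm_num
  have e1 : (80 + Real.sin (Real.pi/2) ^ 2) ^ (1/4 : ℝ) = 3 := by
    rw [Real.sin_pi_div_two, show (80 + 1 ^ 2 : ℝ) = 3^(4:ℝ) by norm_num,
      ← Real.rpow_mul (by positivity)]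
    norm_num
  simp only [e0, e1] at h
  refine ⟨?_, h.2.2 ?_⟩
  · rw [h.1, integral_const_mul]
  · apply Integrable.const_mul
    apply (ContinuousOn.integrableOn_Icc (a := 0) (b := Real.pi/2) _).mono_set Ioo_subset_Icc_self
    apply Continuous.continuousOn
    apply Continuous.rpow_const (by fun_prop)
    intro x; left
    have := Real.cos_sq_le_one x
    linarith

lemma stepB (r : ℝ) (h0 : 0 < r) (hr : r^4 = 5) :
    ∫ y in Ioo (2*r) 3, GG y = (1/(12*r)) * ∫ y in Ioo (2*r) 3, GG y * (6*r+y^2) := by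
  have hb := r_bounds r h0 hr
  have hpos : ∀ x ∈ Icc (2*r) 3, 0 < x := fun x hx => lt_of_lt_of_le (by positivity) hx.1
  have h := subst_anti (a := 2*r) (b := 3) (by linarith) (f := fun y => 6*r/y)
    (f' := fun y => - (6*r)/y^2)
    (by
      intro x hx
      have := (hpos x hx).ne'
      apply ContinuousAt.continuousWithinAt
      fun_prop (disch := assumption))
    (by
      intro x hx
      have h1 := (hpos x (Ioo_subset_Icc_self hx)).ne'
      convert! (hasDerivAt_inv h1).const_mul (6*r) using 1
      field_simp)
    (by
      intro x hx
      have h1 := (hpos x (Ioo_subset_Icc_self hx))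
      rw [neg_div, neg_lt_zero]; positivity)
    GG (fun y => GG y * y^2/(6*r))
    (by
      intro x hx
      have h1 := (hpos x (Ioo_subset_Icc_self hx))
      have h2 : ((6*r/x)^4 - 80) * (81 - (6*r/x)^4) = (36*r^2/x^4)^2*((x^4-80)*(81-x^4)) := by
        field_simp
        grind
      have : 0 < 36*r^2/x^4 := by positivity
      simp only [GG]
      rw [h2, Real.sqrt_mul (by positivity), Real.sqrt_sq this.le]
      field_simp
      norm_num)
  have e0 : 6*r/(2*r) = 3 := by field_simp; norm_num
  have e1 : 6*r/3 = 2*r := by ring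
  simp only [e0, e1] at h
  have hi := (stepA r h0 hr).2
  have h3 : ∫ y in Ioo (2*r) 3, GG y * (6*r+y^2) =
      (6*r) * (∫ y in Ioo (2*r) 3, GG y) + (6*r) * ∫ y in Ioo (2*r) 3, GG y * y^2/(6*r) := by
    rw [← integral_const_mul, ← integral_const_mul, ← integral_add (hi.const_mul _) ((h.2.1 hi).const_mul _)]
    congr 1
    ext y
    field_simp
  rw [h3, ← h.1]
  field_simp
  ring

lemma stepC (r : ℝ) (h0 : 0 < r) (hr : r^4 = 5) :
    ∫ s in Ioo (-((2+r^2)*(3-2*r))) ((2+r^2)*(3-2*r)), qq r s =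
      (1/(2+r^2)) * ∫ y in Ioo (2*r) 3, GG y * (6*r+y^2) := by
  have hb := r_bounds r h0 hr
  have hpos : ∀ x ∈ Icc (2*r) 3, 0 < x := fun x hx => lt_of_lt_of_le (by positivity) hx.1
  have h := subst_lem (a := 2*r) (b := 3) (by linarith) (f := fun y => (2+r^2)*(y-6*r/y))
    (f' := fun y => (2+r^2)*(1+(6*r)/y^2))
    (by
      intro x hx
      have := (hpos x hx).ne'
      apply ContinuousAt.continuousWithinAt
      fun_prop (disch := assumption))
    (by
      intro x hx
      have h1 := (hpos x (Ioo_subset_Icc_self hx)).ne'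
      convert! ((hasDerivAt_id x).sub ((hasDerivAt_inv h1).const_mul (6*r))).const_mul (2+r^2) using 1
      field_simp
      ring)
    (by
      intro x hx
      have h1 := (hpos x (Ioo_subset_Icc_self hx))
      positivity)
    (qq r) (fun y => (1/(2+r^2)) * (GG y * (6*r+y^2)))
    (by
      intro x hx
      have h1 := (hpos x (Ioo_subset_Icc_self hx))
      have h2 : 1 - 2*(12*r*(9+4*r^2))*((2+r^2)*(x-6*r/x))^2 - ((2+r^2)*(x-6*r/x))^4 = ((2+r^2)^2/x^2)^2*((x^4-80)*(81-x^4)) := by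
        field_simp
        grind
      have : 0 < (2+r^2)^2/x^2 := by positivity
      simp only [GG, qq]
      rw [h2, Real.sqrt_mul (by positivity), Real.sqrt_sq this.le]
      field_simp
      ring)
  have e0 : (2+r^2)*(2*r-6*r/(2*r)) = -((2+r^2)*(3-2*r)) := by field_simp; ring
  have e1 : (2+r^2)*(3-6*r/3) = ((2+r^2)*(3-2*r)) := by ring
  simp only [e0, e1] at h
  rw [h.1, integral_const_mul]

lemma stepD (r : ℝ) (h0 : 0 < r) (hr : r^4 = 5) :
    ∫ w in Ioo (-1:ℝ) 1, 1/√(1-w^4) =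
      (5*(2+r^2)) * ∫ s in Ioo (-((2+r^2)*(3-2*r))) ((2+r^2)*(3-2*r)), qq r s := by
  have hb := r_bounds r h0 hr
  have kp := fun z => key_poly r z hr
  set s0 := (2+r^2)*(3-2*r) with hs0
  have hs0p : 0 < s0 := mul_pos (by positivity) (by linarith)
  have hs0b : s0 < 0.0425 := by
    have : r^2 < 2.24 := by nlinarith
    have : (2+r^2)*(3-2*r) < (2+2.24)*(3-2*1.495) := by
      apply mul_lt_mul'' <;> first | linarith | positivity
    rw [hs0]; linarith
  have hz : ∀ s ∈ Icc (-s0) s0, s^2 ≤ 0.002 := by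
    intro s hs
    nlinarith [hs.1, hs.2]
  have hN : s0 * (5*(2+r^2) + 5*r*(7+3*r^2)*s0^2 + (s0^2)^2) =
     1 - 5*r*(7+3*r^2)*s0^2 + 5*(2+r^2)*(s0^2)^2 := by
    rw [hs0]; clear * - hr
    grind
  obtain ⟨a, ha⟩ : ∃ a, a = 5*(2+r^2) := ⟨_, rfl⟩
  obtain ⟨b, hbd⟩ : ∃ b, b = 5*r*(7+3*r^2) := ⟨_, rfl⟩
  have hr2 : 2.23 < r^2 ∧ r^2 < 2.24 := by constructor <;> nlinarith
  have hap : 0 < a ∧ a < 22 := by rw [ha]; constructor <;> linarith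
  have hbp : 50 < b ∧ b < 110 := by
    rw [hbd]; constructor <;> nlinarith
  simp only [← ha, ← hbd] at kp hN ⊢
  have hD : ∀ s ∈ Icc (-s0) s0, 0 < 1 - b*s^2 + a*(s^2)^2 := by
    intro s hs
    have := hz s hs
    have : 0 ≤ a*(s^2)^2 := by have := hap.1; positivity
    nlinarith [sq_nonneg s]
  have h := subst_lem (a := -s0) (b := s0) (by linarith)
    (f := fun s => s * (a + b*s^2 + (s^2)^2) / (1 - b*s^2 + a*(s^2)^2))
    (f' := fun s => ((a+3*b*s^2+5*(s^2)^2)*(1 - b*s^2 + a*(s^2)^2) + 2*s^2*(a + b*s^2 + (s^2)^2)*(b-2*a*s^2)) / (1 - b*s^2 + a*(s^2)^2)^2)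
    (by
      intro x hx
      have := (hD x hx).ne'
      apply ContinuousAt.continuousWithinAt
      fun_prop (disch := assumption))
    (by
      intro x hx
      have h1 := (hD x (Ioo_subset_Icc_self hx)).ne'
      have hp2 : HasDerivAt (fun s : ℝ => s^2) (2*x) x := by simpa using hasDerivAt_pow 2 x
      have hp4 : HasDerivAt (fun s : ℝ => (s^2)^2) (2*x^2*(2*x)) x := by simpa using! hp2.pow 2
      have hNd : HasDerivAt (fun s => s * (a + b*s^2 + (s^2)^2)) _ x :=
        (hasDerivAt_id x).mul (((hp2.const_mul b).const_add a).add hp4)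
      have hDd : HasDerivAt (fun s => 1 - b*s^2 + a*(s^2)^2) _ x :=
        ((hp2.const_mul b).const_sub 1).add (hp4.const_mul a)
      convert! hNd.div hDd h1 using 1
      congr 1
      simp only [id, Pi.add_apply]
      ring)
    (by
      intro x hx
      have h1 := hD x (Ioo_subset_Icc_self hx)
      have h2 := hz x (Ioo_subset_Icc_self hx)
      have h3 : 0 < b - 2*a*x^2 := by nlinarith [sq_nonneg x]
      have := hap.1
      have : 0 < b := by linarith
      positivity)
    (fun w => 1/√(1-w^4)) (fun s => a * qq r s)
    (by
      intro x hx
      have h1 := hD x (Ioo_subset_Icc_self hx)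
      have h2 := hz x (Ioo_subset_Icc_self hx)
      have h3 : 0 < b - 2*a*x^2 := by nlinarith [sq_nonneg x]
      have ha0 := hap.1
      have hb0 : 0 < b := by linarith
      have hW : 0 < (a+3*b*x^2+5*(x^2)^2)*(1 - b*x^2 + a*(x^2)^2) + 2*x^2*(a + b*x^2 + (x^2)^2)*(b-2*a*x^2) := by positivity
      have k := kp (x^2)
      simp only [qq]
      rw [show x^4 = (x^2)^2 by ring]
      generalize hq : 1 - 2*(12*r*(9+4*r^2))*x^2 - (x^2)^2 = q at *
      generalize hWW : (a+3*b*x^2+5*(x^2)^2)*(1 - b*x^2 + a*(x^2)^2) + 2*x^2*(a + b*x^2 + (x^2)^2)*(b-2*a*x^2) = W at *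
      generalize hDD : 1 - b*x^2 + a*(x^2)^2 = D at *
      generalize hNN : a + b*x^2 + (x^2)^2 = N at *
      have : 1 - (x*N/D)^4 = (W/(a*D^2))^2 * q := by
        field_simp
        linarith
      have hp : 0 < W/(a*D^2) := by positivity
      rw [this, Real.sqrt_mul (by positivity), Real.sqrt_sq hp.le]
      field_simp)
  have hD0 := hD s0 (by constructor <;> linarith)
  have e1 : s0 * (a + b*s0^2 + (s0^2)^2) / (1 - b*s0^2 + a*(s0^2)^2) = 1 := by
    rw [hN]; exact div_self hD0.ne'
  have e0 : -s0 * (a + b*(-s0)^2 + ((-s0)^2)^2) / (1 - b*(-s0)^2 + a*((-s0)^2)^2) = -1 := by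
    rw [neg_sq, neg_mul, neg_div, e1]
  simp only [e0, e1] at h
  rw [h.1, integral_const_mul]

lemma stepE : ∫ w in Ioo (-1:ℝ) 1, 1/√(1-w^4) =
    Real.Gamma (1/4)^2 / (2 * √(2 * Real.pi)) := by
  have h1 : ∫ w in Ioo (-1:ℝ) 1, 1/√(1-w^4) = 2 * ∫ w in Ioo (0:ℝ) 1, 1/√(1-w^4) := by
    have h := integral_comp_abs (f := (Iio (1:ℝ)).indicator (fun w => 1/√(1-w^4)))
    rw [setIntegral_indicator measurableSet_Iio, Ioi_inter_Iio] at h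
    rw [← h, ← integral_indicator measurableSet_Ioo]
    congr 1
    ext x
    simp only [indicator, mem_Ioo, mem_Iio, abs_lt]
    rw [show |x|^4 = x^4 by rw [show 4 = 2*2 by norm_num, pow_mul, sq_abs, ← pow_mul]]
  have h2 := (subst_lem (a := 0) (b := 1) (by norm_num) (f := fun x : ℝ => x^4)
    (f' := fun x => 4*x^3) (by fun_prop) (fun x _ => by simpa using hasDerivAt_pow 4 x)
    (fun x hx => by have := hx.1; positivity)
    (fun x => x^(1/4-1:ℝ) * (1-x)^(1/2-1:ℝ)) (fun w => 4 * (1/√(1-w^4)))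
    (fun x hx => by
      have hx0 := hx.1
      have h3 : (x^4)^(1/4-1:ℝ) = 1/x^3 := by
        rw [← Real.rpow_natCast, ← Real.rpow_mul hx0.le]
        norm_num
      have h4 : 0 ≤ 1 - x^4 := by
        have := pow_le_one₀ (n := 4) hx0.le hx.2.le
        linarith
      rw [h3, Real.sqrt_eq_rpow, show (1/2-1:ℝ) = -(1/2) by norm_num, Real.rpow_neg h4]
      field_simp)).1
  norm_num only [integral_const_mul] at h2
  have h3 := ProbabilityTheory.beta_eq_betaIntegralReal (1/4) (1/2) (by norm_num) (by norm_num)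
  have h4 : Complex.betaIntegral ((1/4:ℝ):ℂ) ((1/2:ℝ):ℂ) =
      ((∫ x in Ioo (0:ℝ) 1, x^(1/4-1:ℝ) * (1-x)^(1/2-1:ℝ) : ℝ) : ℂ) := by
    rw [Complex.betaIntegral, intervalIntegral.integral_of_le zero_le_one,
      integral_Ioc_eq_integral_Ioo, ← integral_complex_ofReal]
    apply setIntegral_congr_fun measurableSet_Ioo
    intro x hx
    have := hx.1.le
    have h1 : 0 ≤ 1 - x := by linarith [hx.2]
    simp only
    push_cast [Complex.ofReal_cpow this, Complex.ofReal_cpow h1]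
    rfl
  rw [h4, Complex.ofReal_re] at h3
  norm_num only at h3
  rw [← h3] at h2
  have h5 := Real.Gamma_mul_Gamma_one_sub (1/4)
  have h6 : Real.sin (Real.pi * (1/4)) = √2/2 := by
    rw [mul_one_div, Real.sin_pi_div_four]
  rw [h6] at h5
  rw [ProbabilityTheory.beta] at h2
  norm_num only at h2 h5 ⊢
  rw [Real.Gamma_one_half_eq] at h2
  have hG : 0 < Real.Gamma (1/4) := Real.Gamma_pos_of_pos (by norm_num)
  have hG3 : 0 < Real.Gamma (3/4) := Real.Gamma_pos_of_pos (by norm_num)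
  have h7 : Real.Gamma (3/4) = √2 * Real.pi / Real.Gamma (1/4) := by
    rw [eq_div_iff hG.ne', mul_comm, h5]
    have : √2^2 = 2 := Real.sq_sqrt (by norm_num)
    field_simp
    linarith
  rw [h7] at h2
  norm_num only at h1
  rw [h1]
  have hp := Real.pi_pos
  have hsp : √Real.pi^2 = Real.pi := Real.sq_sqrt hp.le
  have : ∫ w in Ioo (0:ℝ) 1, 1/√(1-w^4) = (1/4) * (Real.Gamma (1/4) * √Real.pi / (√2 * Real.pi / Real.Gamma (1/4))) := by
    linarith
  rw [this, Real.sqrt_mul (by norm_num)]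
  field_simp
  rw [hsp]
  ring

theorem stmt10 : twoFone (1/2) (3/4) (1) (1/81) = (9/100) * Real.sqrt 2 * (5:ℝ) ^ ((3:ℝ)/4) * Real.Gamma (1/4) ^ 2 / Real.pi ^ ((3:ℝ)/2) := by
  obtain ⟨r, hrd⟩ : ∃ r, r = (5:ℝ)^(1/4:ℝ) := ⟨_, rfl⟩
  have h0 : 0 < r := by rw [hrd]; positivity
  have hr : r^4 = 5 := by
    rw [hrd, ← Real.rpow_natCast, ← Real.rpow_mul (by norm_num)]; norm_num
  have h5 : (5:ℝ)^((3:ℝ)/4) = r^3 := by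
    rw [hrd, ← Real.rpow_natCast, ← Real.rpow_mul (by norm_num)]; norm_num
  have hp := Real.pi_pos
  have hpi : Real.pi ^ ((3:ℝ)/2) = Real.pi * √Real.pi := by
    rw [Real.sqrt_eq_rpow, show (3:ℝ)/2 = 1 + 1/2 by norm_num, Real.rpow_add hp, Real.rpow_one]
  have hA := (stepA r h0 hr).1
  have hB := stepB r h0 hr
  have hC := stepC r h0 hr
  have hD := stepD r h0 hr
  rw [stepE] at hD
  rw [series_int, h5, hpi]
  rw [hC] at hD
  rw [hA] at hB
  generalize (∫ y in Ioo (2*r) 3, GG y * (6*r+y^2)) = X at *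
  generalize (∫ t in Ioo 0 (Real.pi/2), (1 - Real.cos t ^ 2 / 81) ^ (-(3/4) : ℝ)) = Y at *
  have hX : X = Real.Gamma (1/4)^2 / (2 * √(2 * Real.pi)) / 5 := by
    rw [hD]; field_simp
  have hY : Y = 54 * (1/(12*r) * X) := by linarith
  rw [hY, hX, Real.sqrt_mul (by norm_num)]
  have : √2^2 = 2 := Real.sq_sqrt (by norm_num)
  field_simp
  rw [hr, this]
  norm_num
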